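/- arXiv:2312.04079 — 7 statements merged into one kernel-verified Lean document; each statement's English description precedes it below -/
import Mathlib

section
/- Let n, l : ℕ and let 𝓗 be a nonempty finite set of functions from (Fin n → Bool) to (Fin l → Bool) that is 2-universal, i.e. for all x ≠ x' in Fin n → Bool, 2^l · #{H ∈ 𝓗 | H x = H x'} ≤ #𝓗. Let Ω be a finite nonempty type equipped with a probability mass function P, let S, T : Ω → (Fin n → Bool), and let HPA : (Fin n → Bool) → κ be any function into any type κ. Then, drawing H uniformly from 𝓗 independently of ω ~ P, the probability that HPA (S ω) ≠ HPA (T ω) and H (S ω) = H (T ω) is at most 2^{−l}; formally, ∑_{ω} P ω · ((#{H ∈ 𝓗 | H (S ω) = H (T ω) ∧ HPA (S ω) ≠ HPA (T ω)}) / #𝓗) ≤ (2^l)⁻¹. -/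
/-- Correctness from 2-universal hashing: if `𝓗` is a 2-universal family of hash
functions with outputs of length `l`, then for raw keys `S ω`, `T ω` drawn
according to a probability mass function `P` and a uniformly random `H ∈ 𝓗`,
the probability that the privacy-amplified keys differ while the verification
hashes agree is at most `2⁻ˡ`. -/
theorem correctness_two_universal_hashing
    (n l : ℕ) (𝓗 : Finset ((Fin n → Bool) → (Fin l → Bool))) (h𝓗 : 𝓗.Nonempty)
    (huniv : ∀ x x' : Fin n → Bool, x ≠ x' →
      2 ^ l * (𝓗.filter (fun H => H x = H x')).card ≤ 𝓗.card)
    (Ω : Type*) [Fintype Ω] [Nonempty Ω]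
    (P : Ω → ℝ) (hP : ∀ ω, 0 ≤ P ω) (hPsum : ∑ ω, P ω = 1)
    (S T : Ω → (Fin n → Bool))
    (κ : Type*) [DecidableEq κ] (HPA : (Fin n → Bool) → κ) :
    ∑ ω, P ω *
        (((𝓗.filter (fun H => H (S ω) = H (T ω) ∧ HPA (S ω) ≠ HPA (T ω))).card : ℝ)
          / (𝓗.card : ℝ))
      ≤ ((2 : ℝ) ^ l)⁻¹ := by
  have hc : (0 : ℝ) < 𝓗.card := by exact_mod_cast h𝓗.card_pos
  have key : ∀ ω, ((𝓗.filter (fun H => H (S ω) = H (T ω) ∧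
      HPA (S ω) ≠ HPA (T ω))).card : ℝ) / (𝓗.card : ℝ) ≤ ((2 : ℝ) ^ l)⁻¹ := by
    intro ω
    by_cases h : HPA (S ω) = HPA (T ω)
    · simp [h]
    · have hne : S ω ≠ T ω := fun e => h (by rw [e])
      have h1 := huniv _ _ hne
      have h2 : 2 ^ l * ((𝓗.filter (fun H => H (S ω) = H (T ω))).card : ℝ) ≤ 𝓗.card := by
        exact_mod_cast h1
      simp only [ne_eq, h, not_false_eq_true, and_true]
      rw [div_le_iff₀ hc, inv_mul_eq_div, le_div_iff₀ (by positivity)]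
      linarith
  calc _ ≤ ∑ ω, P ω * ((2 : ℝ) ^ l)⁻¹ :=
        Finset.sum_le_sum fun ω _ => mul_le_mul_of_nonneg_left (key ω) (hP ω)
    _ = _ := by rw [← Finset.sum_mul, hPsum, one_mul]
end

section
/- Let n ≥ 1 be a natural number, let ω ∈ [0, 1), δ > 0, γ ∈ (0, 1] and ε ∈ (0, 1] be reals. If γ ≥ ((2(1 − ω) + δ)/(δ² · n)) · Real.log (1/ε), then for the binomial distribution with n independent trials each succeeding with probability γ·(1 − ω), the probability of strictly more than (1 − ω + δ)·γ·n successes is at most ε. -/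
open Finset

/-- Parameter-estimation completeness: if
`γ ≥ ((2(1-ω)+δ)/(δ²·n))·ln(1/ε)`, then for a binomial distribution with `n`
trials of success probability `γ·(1-ω)`, the probability of strictly more than
`(1-ω+δ)·γ·n` successes is at most `ε`. -/
theorem parameter_estimation_completeness (n : ℕ) (hn : 1 ≤ n)
    (ω δ γ ε : ℝ)
    (hω : ω ∈ Set.Ico (0 : ℝ) 1) (hδ : 0 < δ)
    (hγ : γ ∈ Set.Ioc (0 : ℝ) 1) (hε : ε ∈ Set.Ioc (0 : ℝ) 1)
    (hγge : γ ≥ ((2 * (1 - ω) + δ) / (δ ^ 2 * n)) * Real.log (1 / ε)) :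
    ∑ k ∈ Finset.range (n + 1),
        (if (1 - ω + δ) * γ * n < (k : ℝ) then
          (n.choose k : ℝ) * (γ * (1 - ω)) ^ k * (1 - γ * (1 - ω)) ^ (n - k)
        else 0)
      ≤ ε := by
  obtain ⟨hω0, hω1⟩ := hω
  obtain ⟨hγ0, hγ1⟩ := hγ
  obtain ⟨hε0, hε1⟩ := hε
  have hn0 : (0 : ℝ) < n := by exact_mod_cast hn
  obtain ⟨q, hq⟩ : ∃ q, q = 1 - ω := ⟨_, rfl⟩
  rw [← hq] at hγge ⊢
  have hq0 : 0 < q := by linarith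
  have hq1 : q ≤ 1 := by linarith
  have hp0 : 0 ≤ γ * q := by positivity
  have hp1 : γ * q ≤ 1 := by nlinarith
  have hx0 : 0 < δ / q := by positivity
  obtain ⟨t, ht⟩ : ∃ t, t = Real.log (1 + δ / q) := ⟨_, rfl⟩
  have ht0 : 0 ≤ t := by rw [ht]; exact Real.log_nonneg (by linarith)
  have hexp : Real.exp t = 1 + δ / q := by rw [ht, Real.exp_log (by linarith)]
  have hlog : 2 * δ / (2 * q + δ) ≤ t := by
    have h := Real.le_log_one_add_of_nonneg hx0.le
    rw [← ht] at h
    refine le_trans (le_of_eq ?_) h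
    field_simp
    ring
  have hsum : ∑ k ∈ Finset.range (n + 1),
        (if (q + δ) * γ * n < (k : ℝ) then
          (n.choose k : ℝ) * (γ * q) ^ k * (1 - γ * q) ^ (n - k)
        else 0) ≤ Real.exp (-((q + δ) * γ * n * t)) *
          (γ * q * Real.exp t + (1 - γ * q)) ^ n := by
    rw [add_pow, Finset.mul_sum]
    refine Finset.sum_le_sum fun k _ => ?_
    have hc : 0 ≤ (n.choose k : ℝ) * (γ * q) ^ k * (1 - γ * q) ^ (n - k) := by
      have : 0 ≤ 1 - γ * q := by linarith
      positivity
    have he : Real.exp (-((q + δ) * γ * n * t)) *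
        ((γ * q * Real.exp t) ^ k * (1 - γ * q) ^ (n - k) * (n.choose k : ℝ)) =
        Real.exp (((k : ℝ) - (q + δ) * γ * n) * t) *
        ((n.choose k : ℝ) * (γ * q) ^ k * (1 - γ * q) ^ (n - k)) := by
      rw [sub_mul, sub_eq_add_neg ((k : ℝ) * t), Real.exp_add, Real.exp_nat_mul, mul_pow]
      ring
    rw [he]
    split_ifs with h
    · apply le_mul_of_one_le_left hc
      apply Real.one_le_exp
      exact mul_nonneg (by linarith) ht0
    · exact mul_nonneg (Real.exp_pos _).le hc
  refine hsum.trans ?_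
  have hbase : γ * q * Real.exp t + (1 - γ * q) = γ * δ + 1 := by
    rw [hexp]; field_simp; ring
  rw [hbase]
  have hpow : (γ * δ + 1) ^ n ≤ Real.exp (n * (γ * δ)) := by
    rw [Real.exp_nat_mul]
    exact pow_le_pow_left₀ (by positivity) (Real.add_one_le_exp _) n
  have hL : Real.log (1 / ε) ≤ γ * n * (δ ^ 2 / (2 * q + δ)) := by
    have h := mul_le_mul_of_nonneg_right hγge (by positivity : 0 ≤ n * (δ ^ 2 / (2 * q + δ)))
    have e : (2 * q + δ) / (δ ^ 2 * n) * Real.log (1 / ε) * (n * (δ ^ 2 / (2 * q + δ)))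
        = Real.log (1 / ε) := by
      have : 2 * q + δ ≠ 0 := by positivity
      field_simp
    rw [e] at h
    linarith
  rw [one_div, Real.log_inv] at hL
  have hkey : (q + δ) * γ * n * (2 * δ / (2 * q + δ)) ≤ (q + δ) * γ * n * t :=
    mul_le_mul_of_nonneg_left hlog (by positivity)
  have hid : (q + δ) * γ * n * (2 * δ / (2 * q + δ)) =
      n * (γ * δ) + γ * n * (δ ^ 2 / (2 * q + δ)) := by
    field_simp
    ring
  calc _ ≤ Real.exp (-((q + δ) * γ * n * t)) * Real.exp (n * (γ * δ)) :=
        mul_le_mul_of_nonneg_left hpow (Real.exp_pos _).le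
    _ = Real.exp (-((q + δ) * γ * n * t) + n * (γ * δ)) := (Real.exp_add _ _).symm
    _ ≤ Real.exp (Real.log ε) := Real.exp_le_exp.mpr (by linarith)
    _ = ε := Real.exp_log hε0
end

section
/- Fix reals ω₃ ∈ (0, 1), β ∈ [ω₃, 1], ω ∈ (0, 1), and εPE, εs, εsec ∈ (0, 1) with 2·εs < εsec. Define g : ℝ → ℝ by g(p) := (p − β)/((Real.log 2)·(1 − β + ω₃)) − Real.logb 2 (1 − β + ω₃), the binary entropy h(x) := −x·Real.logb 2 x − (1 − x)·Real.logb 2 (1 − x), Q := 1 − ω, η := (2·Real.log 2)/(1 + 2·Real.log 2), and ϑ(x) := −Real.logb 2 (1 − Real.sqrt (1 − x²)). For each natural n ≥ 1 define δₙ := n^(−1/3), γₙ := ((2(1 − ω) + δₙ)/(δₙ²·n))·Real.log (1/εPE), κₙ := Real.sqrt ((Real.log 8 − Real.log εs)/n), Vₙ := Real.logb 2 17 + Real.sqrt (2 + (g 1 − g 0)²/γₙ), and d₁ₙ := Real.sqrt (((2·Real.log 2)·Vₙ²/η)·(ϑ(εs/2) + (2 − η)·Real.logb 2 (2/εsec))).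 Let d₀ : ℕ → ℝ be any bounded sequence, let λ : ℕ → ℝ satisfy λ n / n → h(Q), and let lEC ∈ ℝ. Then the sequence ( n·g(ω − δₙ) − d₁ₙ·Real.sqrt n − d₀ₙ − (2 − ω + δₙ)·n·(γₙ + κₙ) − 2·ϑ(εs/4) − lEC − λ n − 2·Real.logb 2 (1/(εsec − 2·εs)) ) / n converges to g(ω) − h(Q) as n → ∞. -/
open Filter

/-- Asymptotic key rate: with the paper's choices of parameter-estimation
tolerance `δ n = n^(-1/3)`, testing probability `γ n`, excess test-round
parameter `κ n`, GEAT correction terms `d₁ n` and `d₀ n`, syndrome length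
`λEC n` with `λEC n / n → h Q`, the finite key rate `l_key/n` converges to the
asymptotic rate `g ω - h Q`. -/
theorem asymptotic_key_rate
    (ω₃ β ω εPE εs εsec : ℝ)
    (hω₃ : ω₃ ∈ Set.Ioo (0 : ℝ) 1) (hβ : β ∈ Set.Icc ω₃ 1)
    (hω : ω ∈ Set.Ioo (0 : ℝ) 1)
    (hεPE : εPE ∈ Set.Ioo (0 : ℝ) 1) (hεs : εs ∈ Set.Ioo (0 : ℝ) 1)
    (hεsec : εsec ∈ Set.Ioo (0 : ℝ) 1) (hss : 2 * εs < εsec)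
    (g : ℝ → ℝ)
    (hg : ∀ p, g p = (p - β) / (Real.log 2 * (1 - β + ω₃))
                      - Real.logb 2 (1 - β + ω₃))
    (h : ℝ → ℝ)
    (hh : ∀ x, h x = -x * Real.logb 2 x - (1 - x) * Real.logb 2 (1 - x))
    (Q η : ℝ) (hQ : Q = 1 - ω)
    (hη : η = (2 * Real.log 2) / (1 + 2 * Real.log 2))
    (ϑ : ℝ → ℝ) (hϑ : ∀ x, ϑ x = - Real.logb 2 (1 - Real.sqrt (1 - x ^ 2)))
    (δ γ κ V d₁ : ℕ → ℝ)
    (hδ : ∀ n : ℕ, 1 ≤ n → δ n = (n : ℝ) ^ (-(1 : ℝ) / 3))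
    (hγ : ∀ n : ℕ, 1 ≤ n →
      γ n = ((2 * (1 - ω) + δ n) / ((δ n) ^ 2 * n)) * Real.log (1 / εPE))
    (hκ : ∀ n : ℕ, 1 ≤ n →
      κ n = Real.sqrt ((Real.log 8 - Real.log εs) / n))
    (hV : ∀ n : ℕ, 1 ≤ n →
      V n = Real.logb 2 17 + Real.sqrt (2 + (g 1 - g 0) ^ 2 / γ n))
    (hd₁ : ∀ n : ℕ, 1 ≤ n →
      d₁ n = Real.sqrt ((2 * Real.log 2) * (V n) ^ 2 / η *
        (ϑ (εs / 2) + (2 - η) * Real.logb 2 (2 / εsec))))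
    (d₀ : ℕ → ℝ) (hd₀ : ∃ C : ℝ, ∀ n, |d₀ n| ≤ C)
    (lam : ℕ → ℝ) (hlam : Tendsto (fun n : ℕ => lam n / n) atTop (nhds (h Q)))
    (lEC : ℝ) :
    Tendsto
      (fun n : ℕ =>
        ((n : ℝ) * g (ω - δ n) - d₁ n * Real.sqrt n - d₀ n
            - (2 - ω + δ n) * n * (γ n + κ n) - 2 * ϑ (εs / 4)
            - lEC - lam n - 2 * Real.logb 2 (1 / (εsec - 2 * εs))) / n)
      atTop (nhds (g ω - h Q)) := by
  have hn1 : ∀ᶠ n : ℕ in atTop, 1 ≤ n := eventually_ge_atTop 1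
  have hcast : Tendsto (fun n : ℕ => (n : ℝ)) atTop atTop := tendsto_natCast_atTop_atTop
  have hinv : Tendsto (fun n : ℕ => ((n : ℝ))⁻¹) atTop (nhds 0) :=
    tendsto_inv_atTop_zero.comp hcast
  have hδ0 : Tendsto δ atTop (nhds 0) := by
    have h1 : Tendsto (fun n : ℕ => (n : ℝ) ^ (-((1 : ℝ) / 3))) atTop (nhds 0) :=
      (tendsto_rpow_neg_atTop (by norm_num : (0 : ℝ) < 1 / 3)).comp hcast
    refine h1.congr' ?_
    filter_upwards [hn1] with n hn
    rw [hδ n hn]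
    congr 1
    norm_num
  have hδpos : ∀ n : ℕ, 1 ≤ n → 0 < δ n := by
    intro n hn
    rw [hδ n hn]
    have : (0 : ℝ) < n := by exact_mod_cast hn
    positivity
  have hδ3 : ∀ n : ℕ, 1 ≤ n → (δ n) ^ 3 = ((n : ℝ))⁻¹ := by
    intro n hn
    have : (0 : ℝ) < n := by exact_mod_cast hn
    rw [hδ n hn, ← Real.rpow_natCast, ← Real.rpow_mul this.le, ← Real.rpow_neg_one]
    norm_num
  have hnδ : ∀ n : ℕ, 1 ≤ n → (n : ℝ) = ((δ n) ^ 3)⁻¹ := by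
    intro n hn
    rw [hδ3 n hn, inv_inv]
  have hL : 0 < Real.log (1 / εPE) := by
    apply Real.log_pos
    rw [lt_div_iff₀ hεPE.1]
    linarith [hεPE.2]
  have hω1 : 0 < 2 * (1 - ω) := by linarith [hω.2]
  have hγeq : ∀ n : ℕ, 1 ≤ n → γ n = (2 * (1 - ω) + δ n) * δ n * Real.log (1 / εPE) := by
    intro n hn
    have hp := hδpos n hn
    rw [hγ n hn, hnδ n hn]
    congr 1
    field_simp
  have hγ0 : Tendsto γ atTop (nhds 0) := by
    have h1 : Tendsto (fun n => (2 * (1 - ω) + δ n) * δ n * Real.log (1 / εPE)) atTop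
        (nhds ((2 * (1 - ω) + 0) * 0 * Real.log (1 / εPE))) :=
      ((tendsto_const_nhds.add hδ0).mul hδ0).mul tendsto_const_nhds
    rw [mul_zero, zero_mul] at h1
    refine h1.congr' ?_
    filter_upwards [hn1] with n hn
    rw [hγeq n hn]
  have hκ0 : Tendsto κ atTop (nhds 0) := by
    have h1 := ((hinv.const_mul (Real.log 8 - Real.log εs))).sqrt
    rw [mul_zero, Real.sqrt_zero] at h1
    refine h1.congr' ?_
    filter_upwards [hn1] with n hn
    rw [hκ n hn, div_eq_mul_inv]
  have hsq : Tendsto (fun n : ℕ => (Real.sqrt n)⁻¹) atTop (nhds 0) := by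
    have h1 := hinv.sqrt
    rw [Real.sqrt_zero] at h1
    refine h1.congr ?_
    intro n
    rw [Real.sqrt_inv]
  have hV0 : Tendsto (fun n : ℕ => V n * (Real.sqrt n)⁻¹) atTop (nhds 0) := by
    have h1 : Tendsto (fun n : ℕ => (δ n) ^ 2 / ((2 * (1 - ω) + δ n) * Real.log (1 / εPE)))
        atTop (nhds (0 ^ 2 / ((2 * (1 - ω) + 0) * Real.log (1 / εPE)))) :=
      (hδ0.pow 2).div ((tendsto_const_nhds.add hδ0).mul tendsto_const_nhds)
        (by rw [add_zero]; positivity)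
    have h2 := (((hinv.const_mul 2).add (h1.const_mul ((g 1 - g 0) ^ 2))).sqrt).add
      (hsq.const_mul (Real.logb 2 17))
    rw [zero_pow two_ne_zero, zero_div, mul_zero, mul_zero, mul_zero, add_zero, add_zero, Real.sqrt_zero] at h2
    refine h2.congr' ?_
    filter_upwards [hn1] with n hn
    have hp := hδpos n hn
    have hnp : (0 : ℝ) < n := by exact_mod_cast hn
    have hL' := hL
    generalize Real.log (1 / εPE) = L at *
    rw [hV n hn, ← Real.sqrt_inv, add_mul (Real.logb 2 17), ← Real.sqrt_mul' _ (by positivity),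
      add_comm (Real.logb 2 17 * _)]
    congr 2
    rw [hγeq n hn, ← hδ3 n hn]
    have h3 : (2 * (1 - ω) + δ n) ≠ 0 := by positivity
    generalize 2 * (1 - ω) + δ n = A at *
    field_simp
  have hd0 : Tendsto (fun n : ℕ => d₁ n * (Real.sqrt n)⁻¹) atTop (nhds 0) := by
    have h1 := (((hV0.pow 2).const_mul ((2 * Real.log 2) / η *
        (ϑ (εs / 2) + (2 - η) * Real.logb 2 (2 / εsec))))).sqrt
    norm_num at h1
    refine h1.congr' ?_
    filter_upwards [hn1] with n hn
    have hnp : (0 : ℝ) < n := by exact_mod_cast hn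
    rw [hd₁ n hn, ← Real.sqrt_inv, ← Real.sqrt_mul' _ (by positivity)]
    congr 1
    rw [Real.sqrt_inv, mul_pow, inv_pow, Real.sq_sqrt hnp.le]
    ring
  have hdd : Tendsto (fun n : ℕ => d₀ n * ((n : ℝ))⁻¹) atTop (nhds 0) := by
    obtain ⟨C, hC⟩ := hd₀
    have h1 := hinv.const_mul C
    rw [mul_zero] at h1
    refine squeeze_zero_norm ?_ h1
    intro n
    rw [norm_mul, Real.norm_eq_abs, Real.norm_of_nonneg (by positivity : (0 : ℝ) ≤ ((n : ℝ))⁻¹)]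
    exact mul_le_mul_of_nonneg_right (hC n) (by positivity)
  have hgl : Tendsto (fun n => g (ω - δ n)) atTop (nhds (g ω)) := by
    have hc : Continuous g := by
      rw [funext hg]
      fun_prop
    have h1 : Tendsto (fun n => ω - δ n) atTop (nhds (ω - 0)) := tendsto_const_nhds.sub hδ0
    rw [sub_zero] at h1
    exact (hc.tendsto ω).comp h1
  have h2 : Tendsto (fun n => (2 - ω + δ n) * (γ n + κ n)) atTop
      (nhds ((2 - ω + 0) * (0 + 0))) :=
    (tendsto_const_nhds.add hδ0).mul (hγ0.add hκ0)
  have hfin := ((((hgl.sub hd0).sub hdd).sub h2).sub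
    (hinv.const_mul (2 * ϑ (εs / 4) + lEC + 2 * Real.logb 2 (1 / (εsec - 2 * εs))))).sub hlam
  simp only [add_zero, mul_zero, sub_zero] at hfin
  refine hfin.congr' ?_
  filter_upwards [hn1] with n hn
  have hnp : (0 : ℝ) < n := by exact_mod_cast hn
  have hs : (Real.sqrt n)⁻¹ = Real.sqrt n * ((n : ℝ))⁻¹ := by
    have := Real.sqrt_pos.mpr hnp
    field_simp
    exact (Real.sq_sqrt hnp.le).symm
  rw [hs]
  have hnn : (n : ℝ) * ((n : ℝ))⁻¹ = 1 := mul_inv_cancel₀ hnp.ne'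
  rw [div_eq_mul_inv, div_eq_mul_inv]
  linear_combination (-(g (ω - δ n)) + (2 - ω + δ n) * (γ n + κ n)) * hnn
end

section
/- Consider all pairs (α, β) where α : Fin 3 → Fin 3 → ZMod 2 satisfies α x 0 + α x 1 + α x 2 = 0 for every x, and β : Fin 3 → Fin 3 → ZMod 2 satisfies β y 0 + β y 1 + β y 2 = 1 for every y. Then: (i) for every such pair, the set {(x, y) : Fin 3 × Fin 3 | α x y = β y x} has at most 8 elements; and (ii) there exists such a pair for which this set has exactly 8 elements. Hence the classical value of the two-player magic square game with uniform inputs is 8/9. -/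
/-- Classical value of the bipartite magic square game: every deterministic
strategy wins on at most 8 of the 9 input pairs, and some deterministic
strategy wins on exactly 8 of them. -/
theorem magic_square_classical_value :
    (∀ α β : Fin 3 → Fin 3 → ZMod 2,
        (∀ x, α x 0 + α x 1 + α x 2 = 0) →
        (∀ y, β y 0 + β y 1 + β y 2 = 1) →
        (Finset.univ.filter
          (fun p : Fin 3 × Fin 3 => α p.1 p.2 = β p.2 p.1)).card ≤ 8) ∧
    (∃ α β : Fin 3 → Fin 3 → ZMod 2,
        (∀ x, α x 0 + α x 1 + α x 2 = 0) ∧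
        (∀ y, β y 0 + β y 1 + β y 2 = 1) ∧
        (Finset.univ.filter
          (fun p : Fin 3 × Fin 3 => α p.1 p.2 = β p.2 p.1)).card = 8) := by
  constructor
  · intro α β hα hβ
    by_contra hc
    have hle := Finset.card_le_univ (Finset.univ.filter
          (fun p : Fin 3 × Fin 3 => α p.1 p.2 = β p.2 p.1))
    have h9 : Fintype.card (Fin 3 × Fin 3) = 9 := by simp
    have hu := (Finset.card_eq_iff_eq_univ _).1 (show (Finset.univ.filter
          (fun p : Fin 3 × Fin 3 => α p.1 p.2 = β p.2 p.1)).card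
            = Fintype.card (Fin 3 × Fin 3) by omega)
    have h : ∀ x y, α x y = β y x := fun x y => by
      have := Finset.mem_univ ((x, y) : Fin 3 × Fin 3)
      rw [← hu] at this
      simpa using this
    simp only [h] at hα
    have e : (0 : ZMod 2) = 1 + 1 + 1 := by
      linear_combination hβ 0 + hβ 1 + hβ 2 - hα 0 - hα 1 - hα 2
    exact absurd e (by decide)
  · exact ⟨![![1, 1, 0], ![0, 0, 0], ![0, 0, 0]], fun _ => ![1, 0, 0],
      by decide, by decide, by decide⟩
end

section
/- Consider all triples (α, β, χ) where α : Fin 3 → Fin 3 → ZMod 2 satisfies α x 0 + α x 1 + α x 2 = 0 for every x, β : Fin 3 → Fin 3 → ZMod 2 satisfies β y 0 + β y 1 + β y 2 = 1 for every y, and χ : Fin 3 → Fin 3 → ZMod 2 is arbitrary. Then: (i) for every such triple, the set {(x, y) : Fin 3 × Fin 3 | α x y = β y x ∧ χ x y = α x y} has at most 8 elements; and (ii) there exists such a triple for which this set has exactly 8 elements. Hence the classical value of the three-player magic square game is 8/9. -/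
/-- Classical value of the tripartite magic square game: every deterministic
strategy (including the third player's guess `χ`) wins on at most 8 of the 9
input pairs, and some deterministic strategy wins on exactly 8 of them. -/
theorem magic_square_tripartite_classical_value :
    (∀ α β χ : Fin 3 → Fin 3 → ZMod 2,
        (∀ x, α x 0 + α x 1 + α x 2 = 0) →
        (∀ y, β y 0 + β y 1 + β y 2 = 1) →
        (Finset.univ.filter
          (fun p : Fin 3 × Fin 3 =>
            α p.1 p.2 = β p.2 p.1 ∧ χ p.1 p.2 = α p.1 p.2)).card ≤ 8) ∧
    (∃ α β χ : Fin 3 → Fin 3 → ZMod 2,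
        (∀ x, α x 0 + α x 1 + α x 2 = 0) ∧
        (∀ y, β y 0 + β y 1 + β y 2 = 1) ∧
        (Finset.univ.filter
          (fun p : Fin 3 × Fin 3 =>
            α p.1 p.2 = β p.2 p.1 ∧ χ p.1 p.2 = α p.1 p.2)).card = 8) := by
  constructor
  · intro α β χ ha hb
    by_contra hc
    have hle := Finset.card_filter_le (Finset.univ : Finset (Fin 3 × Fin 3))
      (fun p : Fin 3 × Fin 3 => α p.1 p.2 = β p.2 p.1 ∧ χ p.1 p.2 = α p.1 p.2)
    have h9 : (Finset.univ : Finset (Fin 3 × Fin 3)).card = 9 := by decide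
    have heq := Finset.card_filter_eq_iff.mp
      (show (Finset.univ.filter (fun p : Fin 3 × Fin 3 =>
        α p.1 p.2 = β p.2 p.1 ∧ χ p.1 p.2 = α p.1 p.2)).card
          = (Finset.univ : Finset (Fin 3 × Fin 3)).card by omega)
    have h : ∀ x y, α x y = β y x := fun x y => (heq (x, y) (Finset.mem_univ _)).1
    simp only [h] at ha
    have h01 : (0 : ZMod 2) = 1 := by
      calc (0 : ZMod 2)
          = (β 0 0 + β 1 0 + β 2 0) + (β 0 1 + β 1 1 + β 2 1)
            + (β 0 2 + β 1 2 + β 2 2) := by rw [ha 0, ha 1, ha 2]; decide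
        _ = (β 0 0 + β 0 1 + β 0 2) + (β 1 0 + β 1 1 + β 1 2)
            + (β 2 0 + β 2 1 + β 2 2) := by ring
        _ = 1 := by rw [hb 0, hb 1, hb 2]; decide
    exact absurd h01 (by decide)
  · refine ⟨![![1, 0, 1], ![0, 1, 1], ![0, 0, 0]], ![![1, 0, 0], ![0, 1, 0], ![1, 1, 1]],
      ![![1, 0, 1], ![0, 1, 1], ![0, 0, 0]], ?_, ?_, ?_⟩ <;> decide
end

section
/- Let X := !![0, 1; 1, 0], Y := !![0, -Complex.I; Complex.I, 0], Z := !![1, 0; 0, -1] be the Pauli matrices in Matrix (Fin 2) (Fin 2) ℂ, let 1₂ be the 2×2 identity, let ⊗ denote the Kronecker product of 2×2 matrices (a 4×4 matrix), and define O : Fin 3 → Fin 3 → Matrix (Fin 2 × Fin 2) (Fin 2 × Fin 2) ℂ by O 0 0 = 1₂ ⊗ Z, O 0 1 = Z ⊗ 1₂, O 0 2 = Z ⊗ Z, O 1 0 = X ⊗ 1₂, O 1 1 = 1₂ ⊗ X, O 1 2 = X ⊗ X, O 2 0 = −(X ⊗ Z), O 2 1 = −(Z ⊗ X), O 2 2 =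 Y ⊗ Y. Then: (i) for all x y, (O x y)ᴴ = O x y and (O x y) * (O x y) = 1; (ii) for all x and all y, y', O x y * O x y' = O x y' * O x y, and for all y and all x, x', O x y * O x' y = O x' y * O x y; (iii) for every x, O x 0 * O x 1 * O x 2 = 1; (iv) for every y, O 0 y * O 1 y * O 2 y = −1. -/
open Matrix Kronecker

/-- The Pauli matrix X. -/
noncomputable def pauliX : Matrix (Fin 2) (Fin 2) ℂ := !![0, 1; 1, 0]

/-- The Pauli matrix Y. -/
noncomputable def pauliY : Matrix (Fin 2) (Fin 2) ℂ := !![0, -Complex.I; Complex.I, 0]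

/-- The Pauli matrix Z. -/
noncomputable def pauliZ : Matrix (Fin 2) (Fin 2) ℂ := !![1, 0; 0, -1]

/-- The Mermin–Peres magic square of observables. -/
noncomputable def msObs : Fin 3 → Fin 3 → Matrix (Fin 2 × Fin 2) (Fin 2 × Fin 2) ℂ :=
  ![![(1 : Matrix (Fin 2) (Fin 2) ℂ) ⊗ₖ pauliZ,
      pauliZ ⊗ₖ (1 : Matrix (Fin 2) (Fin 2) ℂ),
      pauliZ ⊗ₖ pauliZ],
    ![pauliX ⊗ₖ (1 : Matrix (Fin 2) (Fin 2) ℂ),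
      (1 : Matrix (Fin 2) (Fin 2) ℂ) ⊗ₖ pauliX,
      pauliX ⊗ₖ pauliX],
    ![-(pauliX ⊗ₖ pauliZ),
      -(pauliZ ⊗ₖ pauliX),
      pauliY ⊗ₖ pauliY]]

set_option linter.unusedSimpArgs false
theorem pauli_neg_kron (A B : Matrix (Fin 2) (Fin 2) ℂ) : (-A) ⊗ₖ B = -(A ⊗ₖ B) := by
  ext i j; simp [Matrix.kroneckerMap_apply]
theorem pauli_kron_neg (A B : Matrix (Fin 2) (Fin 2) ℂ) : A ⊗ₖ (-B) = -(A ⊗ₖ B) := by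
  ext i j; simp [Matrix.kroneckerMap_apply]
theorem pauli_XX : pauliX * pauliX = 1 := by
  ext i j; fin_cases i <;> fin_cases j <;> simp [pauliX, Matrix.mul_apply]
theorem pauli_YY : pauliY * pauliY = 1 := by
  ext i j; fin_cases i <;> fin_cases j <;> simp [pauliY, Matrix.mul_apply]
theorem pauli_ZZ : pauliZ * pauliZ = 1 := by
  ext i j; fin_cases i <;> fin_cases j <;> simp [pauliZ, Matrix.mul_apply]
theorem pauli_XZ : pauliX * pauliZ = (-Complex.I) • pauliY := by
  ext i j; fin_cases i <;> fin_cases j <;> simp [pauliX, pauliY, pauliZ, Matrix.mul_apply]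
theorem pauli_ZX : pauliZ * pauliX = Complex.I • pauliY := by
  ext i j; fin_cases i <;> fin_cases j <;> simp [pauliX, pauliY, pauliZ, Matrix.mul_apply]
theorem pauli_XY : pauliX * pauliY = Complex.I • pauliZ := by
  ext i j; fin_cases i <;> fin_cases j <;> simp [pauliX, pauliY, pauliZ, Matrix.mul_apply]
theorem pauli_YX : pauliY * pauliX = (-Complex.I) • pauliZ := by
  ext i j; fin_cases i <;> fin_cases j <;> simp [pauliX, pauliY, pauliZ, Matrix.mul_apply]
theorem pauli_YZ : pauliY * pauliZ = Complex.I • pauliX := by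
  ext i j; fin_cases i <;> fin_cases j <;> simp [pauliX, pauliY, pauliZ, Matrix.mul_apply]
theorem pauli_ZY : pauliZ * pauliY = (-Complex.I) • pauliX := by
  ext i j; fin_cases i <;> fin_cases j <;> simp [pauliX, pauliY, pauliZ, Matrix.mul_apply]
theorem pauli_hX : pauliXᴴ = pauliX := by
  ext i j; fin_cases i <;> fin_cases j <;> simp [pauliX]
theorem pauli_hY : pauliYᴴ = pauliY := by
  ext i j; fin_cases i <;> fin_cases j <;> simp [pauliY]
theorem pauli_hZ : pauliZᴴ = pauliZ := by
  ext i j; fin_cases i <;> fin_cases j <;> simp [pauliZ]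

/-- The defining properties of the Mermin–Peres magic square of observables:
each entry is a self-adjoint involution, entries of each row pairwise commute,
entries of each column pairwise commute, each row multiplies to the identity,
and each column multiplies to minus the identity. -/
theorem mermin_peres_magic_square :
    (∀ x y, (msObs x y)ᴴ = msObs x y ∧ msObs x y * msObs x y = 1) ∧
    (∀ x y y', msObs x y * msObs x y' = msObs x y' * msObs x y) ∧
    (∀ y x x', msObs x y * msObs x' y = msObs x' y * msObs x y) ∧
    (∀ x, msObs x 0 * msObs x 1 * msObs x 2 = 1) ∧
    (∀ y, msObs 0 y * msObs 1 y * msObs 2 y = -1) := by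
  refine ⟨?_, ?_, ?_, ?_, ?_⟩
  · intro x y
    fin_cases x <;> fin_cases y <;> simp [msObs, ← Matrix.mul_kronecker_mul, Matrix.conjTranspose_kronecker, pauli_XX, pauli_YY, pauli_ZZ,
      pauli_XZ, pauli_ZX, pauli_XY, pauli_YX, pauli_YZ, pauli_ZY, pauli_hX, pauli_hY, pauli_hZ,
      Matrix.smul_kronecker, Matrix.kronecker_smul, smul_smul, pauli_neg_kron, pauli_kron_neg]
  · intro x y z
    fin_cases x <;> fin_cases y <;> fin_cases z <;> simp [msObs, ← Matrix.mul_kronecker_mul, Matrix.conjTranspose_kronecker, pauli_XX, pauli_YY, pauli_ZZ,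
      pauli_XZ, pauli_ZX, pauli_XY, pauli_YX, pauli_YZ, pauli_ZY, pauli_hX, pauli_hY, pauli_hZ,
      Matrix.smul_kronecker, Matrix.kronecker_smul, smul_smul, pauli_neg_kron, pauli_kron_neg]
  · intro x y z
    fin_cases x <;> fin_cases y <;> fin_cases z <;> simp [msObs, ← Matrix.mul_kronecker_mul, Matrix.conjTranspose_kronecker, pauli_XX, pauli_YY, pauli_ZZ,
      pauli_XZ, pauli_ZX, pauli_XY, pauli_YX, pauli_YZ, pauli_ZY, pauli_hX, pauli_hY, pauli_hZ,
      Matrix.smul_kronecker, Matrix.kronecker_smul, smul_smul, pauli_neg_kron, pauli_kron_neg]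
  · intro x
    fin_cases x <;> simp [msObs, ← Matrix.mul_kronecker_mul, Matrix.conjTranspose_kronecker, pauli_XX, pauli_YY, pauli_ZZ,
      pauli_XZ, pauli_ZX, pauli_XY, pauli_YX, pauli_YZ, pauli_ZY, pauli_hX, pauli_hY, pauli_hZ,
      Matrix.smul_kronecker, Matrix.kronecker_smul, smul_smul, pauli_neg_kron, pauli_kron_neg]
  · intro x
    fin_cases x <;> simp [msObs, ← Matrix.mul_kronecker_mul, Matrix.conjTranspose_kronecker, pauli_XX, pauli_YY, pauli_ZZ,
      pauli_XZ, pauli_ZX, pauli_XY, pauli_YX, pauli_YZ, pauli_ZY, pauli_hX, pauli_hY, pauli_hZ,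
      Matrix.smul_kronecker, Matrix.kronecker_smul, smul_smul, pauli_neg_kron, pauli_kron_neg]
end

section
/- Let R be a ring in which 2 is invertible. Let A be the set of a : Fin 3 → ZMod 2 with a 0 + a 1 + a 2 = 0 and B the set of b : Fin 3 → ZMod 2 with b 0 + b 1 + b 2 = 1. Let F : R, P : A → R and Q : B → R be such that ∑_{a ∈ A} P a = 1, ∑_{b ∈ B} Q b = 1, F commutes with P a and with Q b for all a, b, and P a commutes with Q b for all a, b. Then for all x, y : Fin 3: F * (∑_{a ∈ A, a y = 0} P a) * (∑_{b ∈ B, b x = 0} Q b) + (1 − F) * (∑_{a ∈ A, a y = 1} P a) * (∑_{b ∈ B, b x = 1} Q b) = ∑_{a ∈ A, a y = 1} ∑_{b ∈ B, b x = 0} ( 2⁻¹ * (F * Q b) + 2⁻¹ * ((1 − F) * P a) − P a * Q b ). -/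
open Finset

/-- The Appendix A simplification of `Π^{xy}` for the tripartite magic square
game: with `A` the even-parity triples and `B` the odd-parity triples, `P`, `Q`
POVM-like families summing to `1`, and `F` a commuting "Eve" element,
`F·(∑_{a[y]=0} P a)·(∑_{b[x]=0} Q b) + (1-F)·(∑_{a[y]=1} P a)·(∑_{b[x]=1} Q b)`
equals the stated double sum. -/
theorem msg_pi_simplification {R : Type*} [Ring R] [Invertible (2 : R)]
    (A B : Finset (Fin 3 → ZMod 2))
    (hA : A = Finset.univ.filter (fun a : Fin 3 → ZMod 2 => a 0 + a 1 + a 2 = 0))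
    (hB : B = Finset.univ.filter (fun b : Fin 3 → ZMod 2 => b 0 + b 1 + b 2 = 1))
    (F : R) (P Q : (Fin 3 → ZMod 2) → R)
    (hP : ∑ a ∈ A, P a = 1) (hQ : ∑ b ∈ B, Q b = 1)
    (hFP : ∀ a ∈ A, Commute F (P a)) (hFQ : ∀ b ∈ B, Commute F (Q b))
    (hPQ : ∀ a ∈ A, ∀ b ∈ B, Commute (P a) (Q b)) :
    ∀ x y : Fin 3,
      F * (∑ a ∈ A.filter (fun a => a y = 0), P a)
          * (∑ b ∈ B.filter (fun b => b x = 0), Q b)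
        + (1 - F) * (∑ a ∈ A.filter (fun a => a y = 1), P a)
          * (∑ b ∈ B.filter (fun b => b x = 1), Q b)
      = ∑ a ∈ A.filter (fun a => a y = 1), ∑ b ∈ B.filter (fun b => b x = 0),
          (⅟(2 : R) * (F * Q b) + ⅟(2 : R) * ((1 - F) * P a) - P a * Q b) := by
  intro x y
  have z2 : ∀ t : ZMod 2, ¬ t = 1 ↔ t = 0 := by decide
  have cA : (A.filter (fun a => a y = 1)).card = 2 := by
    subst hA; revert y; decide
  have cB : (B.filter (fun b => b x = 0)).card = 2 := by
    subst hB; revert x; decide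
  have eP := Finset.sum_filter_add_sum_filter_not A (fun a => a y = 1) P
  have eQ := Finset.sum_filter_add_sum_filter_not B (fun b => b x = 1) Q
  simp only [z2] at eP eQ
  rw [hP] at eP
  rw [hQ] at eQ
  have hR : ∑ a ∈ A.filter (fun a => a y = 1), ∑ b ∈ B.filter (fun b => b x = 0),
          (⅟(2 : R) * (F * Q b) + ⅟(2 : R) * ((1 - F) * P a) - P a * Q b)
      = F * (∑ b ∈ B.filter (fun b => b x = 0), Q b)
        + (1 - F) * (∑ a ∈ A.filter (fun a => a y = 1), P a)
        - (∑ a ∈ A.filter (fun a => a y = 1), P a)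
          * (∑ b ∈ B.filter (fun b => b x = 0), Q b) := by
    simp only [Finset.sum_sub_distrib, Finset.sum_add_distrib, Finset.sum_const, cA, cB,
      ← Finset.mul_sum, ← Finset.sum_mul, ← Finset.smul_sum]
    simp only [nsmul_eq_mul, Nat.cast_ofNat, mul_invOf_cancel_left]
  rw [hR, eq_sub_of_add_eq' eP, eq_sub_of_add_eq eQ]
  noncomm_ring
end
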